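/- Assume additionally that the function x ↦ (|A|_∞(x) + |C|_∞(x)² · Φ_A(x)⁻¹)/(1 + ‖x‖²) + ‖B̄(x)‖/(1 + ‖x‖) is μ-integrable on ℝ^d. Then every bounded C¹ function h : ℝ^d → ℝ satisfying the weak resolvent identity vanishes identically on ℝ^d. -/

import Mathlib

open MeasureTheory Real
open scoped RealInnerProductSpace ENNReal

noncomputable section

/-- `⟨M v, w⟩` for a `d × d` matrix `M` and vectors `v, w ∈ ℝ^d`. -/
def mdot {d : ℕ} (M : Matrix (Fin d) (Fin d) ℝ) (v w : EuclideanSpace ℝ (Fin d)) : ℝ :=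
  ∑ i, ∑ j, M i j * v j * w i

/-- `|M|_∞ = max_{i,j} |m_ij|`. -/
def matSup {d : ℕ} (M : Matrix (Fin d) (Fin d) ℝ) : ℝ :=
  ⨆ i, ⨆ j, |M i j|

/-- `Φ_M = inf_{ξ ≠ 0} ⟨M ξ, ξ⟩ / ‖ξ‖²`. -/
def PhiA {d : ℕ} (M : Matrix (Fin d) (Fin d) ℝ) : ℝ :=
  ⨅ ξ : {ξ : EuclideanSpace ℝ (Fin d) // ξ ≠ 0}, mdot M ξ.1 ξ.1 / ‖ξ.1‖ ^ 2

/-- `h` satisfies the weak resolvent identity: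
`(1/2)∫ ⟨(A+C)∇u, ∇h⟩ dμ + ∫ ⟨B̄, ∇u⟩ h dμ + ∫ u h dμ = 0` for every compactly supported
Lipschitz `u`. -/
def WeakResolvent {d : ℕ} (μ : Measure (EuclideanSpace ℝ (Fin d)))
    (A C : EuclideanSpace ℝ (Fin d) → Matrix (Fin d) (Fin d) ℝ)
    (Bb : EuclideanSpace ℝ (Fin d) → EuclideanSpace ℝ (Fin d))
    (h : EuclideanSpace ℝ (Fin d) → ℝ) : Prop :=
  ∀ u : EuclideanSpace ℝ (Fin d) → ℝ,
    (∃ K, LipschitzWith K u) → HasCompactSupport u →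
    (1/2) * (∫ x, mdot (A x + C x) (gradient u x) (gradient h x) ∂μ)
      + (∫ x, ⟪Bb x, gradient u x⟫ * h x ∂μ)
      + (∫ x, u x * h x ∂μ) = 0


theorem abs_le_matSup {d : ℕ} (M : Matrix (Fin d) (Fin d) ℝ) (i j : Fin d) :
    |M i j| ≤ matSup M :=
  (le_ciSup (f := fun j => |M i j|) (Set.finite_range _).bddAbove j).trans
    (le_ciSup (f := fun i => ⨆ j, |M i j|) (Set.finite_range _).bddAbove i)

theorem matSup_nonneg {d : ℕ} (M : Matrix (Fin d) (Fin d) ℝ) : 0 ≤ matSup M :=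
  Real.iSup_nonneg fun _ => Real.iSup_nonneg fun _ => abs_nonneg _

theorem mdot_add_matrix {d : ℕ} (M N : Matrix (Fin d) (Fin d) ℝ)
    (v w : EuclideanSpace ℝ (Fin d)) : mdot (M + N) v w = mdot M v w + mdot N v w := by
  simp [mdot, add_mul, Finset.sum_add_distrib]

theorem mdot_add_left {d : ℕ} (M : Matrix (Fin d) (Fin d) ℝ)
    (v v' w : EuclideanSpace ℝ (Fin d)) : mdot M (v + v') w = mdot M v w + mdot M v' w := by
  simp [mdot, mul_add, add_mul, Finset.sum_add_distrib]

theorem mdot_smul_left {d : ℕ} (M : Matrix (Fin d) (Fin d) ℝ) (c : ℝ)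
    (v w : EuclideanSpace ℝ (Fin d)) : mdot M (c • v) w = c * mdot M v w := by
  simp only [mdot, Finset.mul_sum, PiLp.smul_apply, smul_eq_mul]
  exact Finset.sum_congr rfl fun i _ => Finset.sum_congr rfl fun j _ => by ring

theorem mdot_transpose {d : ℕ} (M : Matrix (Fin d) (Fin d) ℝ)
    (v w : EuclideanSpace ℝ (Fin d)) : mdot M.transpose v w = mdot M w v := by
  simp only [mdot, Matrix.transpose_apply]
  rw [Finset.sum_comm]
  exact Finset.sum_congr rfl fun i _ => Finset.sum_congr rfl fun j _ => by ring

theorem mdot_comm_of_isSymm {d : ℕ} {M : Matrix (Fin d) (Fin d) ℝ} (hM : M.IsSymm)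
    (v w : EuclideanSpace ℝ (Fin d)) : mdot M v w = mdot M w v := by
  rw [← mdot_transpose, hM.eq]

theorem mdot_self_eq_zero_of_antisymm {d : ℕ} {M : Matrix (Fin d) (Fin d) ℝ}
    (hM : M.transpose = -M) (v : EuclideanSpace ℝ (Fin d)) : mdot M v v = 0 := by
  have h1 := mdot_transpose M v v
  have h2 : mdot (-M) v v = -mdot M v v := by simp [mdot]
  rw [hM, h2] at h1
  linarith

theorem abs_mdot_le {d : ℕ} (M : Matrix (Fin d) (Fin d) ℝ)
    (v w : EuclideanSpace ℝ (Fin d)) :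
    |mdot M v w| ≤ (d : ℝ) ^ 2 * (matSup M * ‖v‖ * ‖w‖) := by
  have hterm : ∀ i j, |M i j * v j * w i| ≤ matSup M * ‖v‖ * ‖w‖ := fun i j => by
    rw [abs_mul, abs_mul]
    have hv : |v j| ≤ ‖v‖ := PiLp.norm_apply_le v j
    have hw : |w i| ≤ ‖w‖ := PiLp.norm_apply_le w i
    have := abs_le_matSup M i j
    have := matSup_nonneg M
    gcongr
  calc |mdot M v w| ≤ ∑ i, ∑ j, |M i j * v j * w i| :=
        (Finset.abs_sum_le_sum_abs _ _).trans
          (Finset.sum_le_sum fun i _ => Finset.abs_sum_le_sum_abs _ _)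
    _ ≤ ∑ _i : Fin d, ∑ _j : Fin d, matSup M * ‖v‖ * ‖w‖ :=
        Finset.sum_le_sum fun i _ => Finset.sum_le_sum fun j _ => hterm i j
    _ = (d : ℝ) ^ 2 * (matSup M * ‖v‖ * ‖w‖) := by simp; ring

theorem continuous_mdot {X : Type*} [TopologicalSpace X] {d : ℕ}
    {M : X → Matrix (Fin d) (Fin d) ℝ} {v w : X → EuclideanSpace ℝ (Fin d)}
    (hM : ∀ i j, Continuous fun x => M x i j) (hv : Continuous v) (hw : Continuous w) :
    Continuous fun x => mdot (M x) (v x) (w x) := by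
  unfold mdot
  exact continuous_finsetSum _ fun i _ => continuous_finsetSum _ fun j _ =>
    ((hM i j).mul (by fun_prop)).mul (by fun_prop)

theorem mdot_self_pos {d : ℕ} {M : Matrix (Fin d) (Fin d) ℝ} (hM : M.PosDef)
    {v : EuclideanSpace ℝ (Fin d)} (hv : v ≠ 0) : 0 < mdot M v v := by
  have hv' : v.ofLp ≠ 0 := fun h => hv (by ext i; simpa using congrFun h i)
  have := hM.dotProduct_mulVec_pos hv'
  simp only [dotProduct, Matrix.mulVec, Pi.star_apply, star_trivial, Finset.mul_sum] at this
  exact this.trans_eq <| Finset.sum_congr rfl fun i _ => Finset.sum_congr rfl fun j _ => by ring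

theorem mdot_self_nonneg {d : ℕ} {M : Matrix (Fin d) (Fin d) ℝ} (hM : M.PosDef)
    (v : EuclideanSpace ℝ (Fin d)) : 0 ≤ mdot M v v := by
  rcases eq_or_ne v 0 with rfl | hv
  · simp [mdot]
  · exact (mdot_self_pos hM hv).le

theorem PhiA_mul_norm_sq_le {d : ℕ} {M : Matrix (Fin d) (Fin d) ℝ} (hM : M.PosDef)
    (v : EuclideanSpace ℝ (Fin d)) : PhiA M * ‖v‖ ^ 2 ≤ mdot M v v := by
  rcases eq_or_ne v 0 with rfl | hv
  · simp [mdot]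
  · have hbdd : BddBelow (Set.range fun ξ : {ξ : EuclideanSpace ℝ (Fin d) // ξ ≠ 0} =>
        mdot M ξ.1 ξ.1 / ‖ξ.1‖ ^ 2) := by
      refine ⟨0, ?_⟩
      rintro _ ⟨ξ, rfl⟩
      exact div_nonneg (mdot_self_nonneg hM _) (by positivity)
    rw [← le_div_iff₀ (by positivity)]
    exact ciInf_le hbdd ⟨v, hv⟩

theorem PhiA_pos {d : ℕ} (hd : 0 < d) {M : Matrix (Fin d) (Fin d) ℝ} (hM : M.PosDef) :
    0 < PhiA M := by
  have : Nonempty (Fin d) := ⟨⟨0, hd⟩⟩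
  obtain ⟨e, he⟩ := exists_ne (0 : EuclideanSpace ℝ (Fin d))
  have : Nonempty {ξ : EuclideanSpace ℝ (Fin d) // ξ ≠ 0} := ⟨⟨e, he⟩⟩
  obtain ⟨x, hx, hmin⟩ := (isCompact_sphere (0 : EuclideanSpace ℝ (Fin d)) 1).exists_isMinOn
    (NormedSpace.sphere_nonempty.2 zero_le_one)
    (continuous_mdot (M := fun _ => M) (fun _ _ => continuous_const) continuous_id
      continuous_id).continuousOn
  have hx0 : x ≠ 0 := ne_zero_of_mem_unit_sphere ⟨x, hx⟩
  refine (mdot_self_pos hM hx0).trans_le (le_ciInf fun ⟨ξ, hξ⟩ => ?_)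
  have hmem : ‖ξ‖⁻¹ • ξ ∈ Metric.sphere (0 : EuclideanSpace ℝ (Fin d)) 1 := by
    simp [norm_smul, norm_ne_zero_iff.2 hξ]
  have hle := isMinOn_iff.1 hmin _ hmem
  simp only [id] at hle
  have hcomm : mdot M ξ (‖ξ‖⁻¹ • ξ) = ‖ξ‖⁻¹ * mdot M ξ ξ := by
    rw [← mdot_transpose, mdot_smul_left, mdot_transpose]
  rw [mdot_smul_left, hcomm] at hle
  refine hle.trans_eq ?_
  rw [div_eq_mul_inv]
  ring

section Gradient

variable {E : Type*} [NormedAddCommGroup E] [InnerProductSpace ℝ E] [CompleteSpace E]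

theorem gradient_fun_mul {f g : E → ℝ} {x : E} (hf : DifferentiableAt ℝ f x)
    (hg : DifferentiableAt ℝ g x) :
    gradient (fun y => f y * g y) x = f x • gradient g x + g x • gradient f x := by
  simp [gradient, fderiv_fun_mul hf hg]

theorem ContDiff.continuous_gradient {f : E → ℝ} (hf : ContDiff ℝ 1 f) :
    Continuous (gradient f) :=
  (InnerProductSpace.toDual ℝ E).symm.continuous.comp (hf.continuous_fderiv one_ne_zero)

theorem HasCompactSupport.gradient {f : E → ℝ} (hf : HasCompactSupport f) :
    HasCompactSupport (gradient f) :=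
  (hf.fderiv (𝕜 := ℝ)).comp_left (g := (InnerProductSpace.toDual ℝ E).symm) (map_zero _)

/-- A smooth cutoff in the variable `log (1 + ‖x‖ ^ 2)`, whose gradient is small relative to
`1 / (1 + ‖x‖)`. -/
theorem exists_cutoff_gradient_le [FiniteDimensional ℝ E] {ε : ℝ} (hε : 0 < ε) (R : ℝ) :
    ∃ χ : E → ℝ, ContDiff ℝ 1 χ ∧ HasCompactSupport χ ∧ (∀ x, 0 ≤ χ x) ∧ (∀ x, χ x ≤ 1) ∧
      (∀ x, ‖x‖ ≤ R → χ x = 1) ∧ (∀ x, ‖gradient χ x‖ ^ 2 ≤ ε / (1 + ‖x‖ ^ 2)) ∧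
      ∀ x, ‖gradient χ x‖ ≤ ε / (1 + ‖x‖) := by
  let φ : ContDiffBump (0 : ℝ) := ⟨1, 2, one_pos, one_lt_two⟩
  have hφ : ContDiff ℝ 1 φ := φ.contDiff
  obtain ⟨L, hL⟩ := φ.hasCompactSupport.deriv.exists_bound_of_continuous
    (hφ.continuous_deriv le_rfl)
  have hL0 : 0 ≤ L := (norm_nonneg _).trans (hL 0)
  obtain ⟨s, hs0, hs1, hs2, hs3⟩ : ∃ s : ℝ, 0 < s ∧ s * log (1 + R ^ 2) < 1 ∧
      4 * L * s < ε ∧ 4 * L ^ 2 * s ^ 2 < ε := by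
    have h1 : ∀ᶠ s in nhds (0 : ℝ), s * log (1 + R ^ 2) < 1 :=
      ContinuousAt.eventually_lt (by fun_prop) continuousAt_const (by simp)
    have h2 : ∀ᶠ s in nhds (0 : ℝ), 4 * L * s < ε :=
      ContinuousAt.eventually_lt (by fun_prop) continuousAt_const (by simpa)
    have h3 : ∀ᶠ s in nhds (0 : ℝ), 4 * L ^ 2 * s ^ 2 < ε :=
      ContinuousAt.eventually_lt (by fun_prop) continuousAt_const (by simpa)
    obtain ⟨s, ⟨h1, h2, h3⟩, hs⟩ :=
      ((((h1.and (h2.and h3)).filter_mono nhdsWithin_le_nhds).and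
        (self_mem_nhdsWithin (s := Set.Ioi (0 : ℝ)))).exists)
    exact ⟨s, hs, h1, h2, h3⟩
  have hq : ∀ x : E, 1 + ‖x‖ ^ 2 ≠ 0 := fun x => by positivity
  have hgrad : ∀ x : E, ‖gradient (fun y : E => φ (s * log (1 + ‖y‖ ^ 2))) x‖
      ≤ 2 * L * s * (‖x‖ / (1 + ‖x‖ ^ 2)) := fun x => by
    have h1 : HasFDerivAt (fun y : E => s * log (1 + ‖y‖ ^ 2))
        (s • ((1 + ‖x‖ ^ 2)⁻¹ • (2 • innerSL ℝ x))) x :=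
      ((((hasStrictFDerivAt_norm_sq x).hasFDerivAt.const_add 1).log (hq x)).const_mul s)
    have h2 := ((hφ.differentiable one_ne_zero _).hasDerivAt).comp_hasFDerivAt x h1
    have h3 : ‖gradient (fun y : E => φ (s * log (1 + ‖y‖ ^ 2))) x‖
        = ‖fderiv ℝ (fun y : E => φ (s * log (1 + ‖y‖ ^ 2))) x‖ := by
      simp [gradient]
    have h4 := h2.fderiv
    rw [Function.comp_def] at h4
    rw [h3, h4, norm_smul, norm_smul, norm_smul, ← Nat.cast_smul_eq_nsmul ℝ, norm_smul,
      innerSL_apply_norm, norm_inv, Real.norm_of_nonneg hs0.le,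
      Real.norm_of_nonneg (by positivity : 0 ≤ 1 + ‖x‖ ^ 2)]
    calc _ ≤ L * (s * ((1 + ‖x‖ ^ 2)⁻¹ * (‖((2 : ℕ) : ℝ)‖ * ‖x‖))) := by
          gcongr
          exact hL _
      _ = _ := by
          rw [div_eq_mul_inv]
          norm_num
          ring
  refine ⟨fun x => φ (s * log (1 + ‖x‖ ^ 2)), ?_, ?_, fun x => φ.nonneg, fun x => φ.le_one,
    fun x hx => ?_, fun x => ?_, fun x => ?_⟩
  · exact hφ.comp (contDiff_const.mul ((contDiff_const.add (contDiff_norm_sq ℝ)).log hq))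
  · refine HasCompactSupport.intro (isCompact_closedBall (0 : E) (exp (1 / s))) fun x hx => ?_
    have hx : exp (1 / s) < ‖x‖ := by simpa using hx
    refine φ.zero_of_le_dist ?_
    have h1 : exp (2 / s) ≤ 1 + ‖x‖ ^ 2 := by
      have : exp (2 / s) = exp (1 / s) ^ 2 := by
        rw [← exp_nat_mul]
        congr 1
        push_cast
        ring
      rw [this]
      nlinarith [exp_pos (1 / s)]
    have h2 : 2 / s ≤ log (1 + ‖x‖ ^ 2) := (le_log_iff_exp_le (by positivity)).2 h1
    rw [div_le_iff₀ hs0] at h2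
    rw [Real.dist_eq, sub_zero]
    exact (h2.trans_eq (mul_comm _ _)).trans (le_abs_self _)
  · refine φ.one_of_mem_closedBall ?_
    have h0 : 0 ≤ log (1 + ‖x‖ ^ 2) := log_nonneg (by nlinarith [norm_nonneg x])
    have h1 : log (1 + ‖x‖ ^ 2) ≤ log (1 + R ^ 2) := by gcongr
    rw [Metric.mem_closedBall, Real.dist_eq, sub_zero, abs_of_nonneg (by positivity)]
    exact (mul_le_mul_of_nonneg_left h1 hs0.le).trans hs1.le
  · have hx : 0 < 1 + ‖x‖ ^ 2 := by positivity
    calc _ ≤ (2 * L * s * (‖x‖ / (1 + ‖x‖ ^ 2))) ^ 2 := by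
          gcongr
          exact hgrad x
      _ = 4 * L ^ 2 * s ^ 2 * (‖x‖ ^ 2 / (1 + ‖x‖ ^ 2)) / (1 + ‖x‖ ^ 2) := by ring
      _ ≤ 4 * L ^ 2 * s ^ 2 * 1 / (1 + ‖x‖ ^ 2) := by
          gcongr
          rw [div_le_one hx]
          linarith
      _ ≤ ε / (1 + ‖x‖ ^ 2) := by
          gcongr
          linarith
  · have hx : 0 < 1 + ‖x‖ ^ 2 := by positivity
    have hle : ‖x‖ / (1 + ‖x‖ ^ 2) ≤ 2 / (1 + ‖x‖) := by
      rw [div_le_div_iff₀ hx (by positivity)]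
      nlinarith [sq_nonneg (‖x‖ - 1)]
    calc _ ≤ 2 * L * s * (‖x‖ / (1 + ‖x‖ ^ 2)) := hgrad x
      _ ≤ 2 * L * s * (2 / (1 + ‖x‖)) := by gcongr
      _ = 4 * L * s / (1 + ‖x‖) := by ring
      _ ≤ ε / (1 + ‖x‖) := by gcongr

end Gradient

theorem MeasureTheory.LocallyIntegrable.integrable_inner_of_hasCompactSupport
    {E : Type*} [NormedAddCommGroup E] [InnerProductSpace ℝ E]
    [MeasurableSpace E] [BorelSpace E] [SecondCountableTopology E] {μ : Measure E}
    {B V : E → E} (hB : Measurable B) (hBloc : LocallyIntegrable (fun x => ‖B x‖) μ)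
    (hV : Continuous V) (hVs : HasCompactSupport V) : Integrable (fun x => ⟪B x, V x⟫) μ := by
  obtain ⟨K, hK⟩ := hVs.exists_bound_of_continuous hV
  have hsupp : Function.support (fun x => ⟪B x, V x⟫) ⊆ tsupport V := fun x hx =>
    subset_tsupport V fun h0 => hx (by simp [h0])
  rw [← integrableOn_iff_integrable_of_support_subset hsupp]
  refine ((hBloc.integrableOn_isCompact hVs.isCompact).mul_const K).mono'
    (hB.inner hV.measurable).aestronglyMeasurable (.of_forall fun x => ?_)
  exact (norm_inner_le_norm _ _).trans (mul_le_mul_of_nonneg_left (hK x) (norm_nonneg _))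

theorem mdot_cutoff_estimate {d : ℕ} (hd : 0 < d) {A C : Matrix (Fin d) (Fin d) ℝ}
    (hAsymm : A.IsSymm) (hApos : A.PosDef) (s t : ℝ) (v w : EuclideanSpace ℝ (Fin d)) :
    -(1 / 2 * (s ^ 2 * mdot A v v) + s * t * mdot A w v + s * t * mdot C w v) ≤
      t ^ 2 * ((d : ℝ) ^ 4 * (matSup A + matSup C ^ 2 * (PhiA A)⁻¹) * ‖w‖ ^ 2) := by
  have hΦ := PhiA_pos hd hApos
  have hd1 : (1 : ℝ) ≤ d := by exact_mod_cast hd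
  have hA : -(s * t * mdot A w v) ≤ 1 / 4 * (s ^ 2 * mdot A v v) + t ^ 2 * mdot A w w := by
    have h0 := mdot_self_nonneg hApos ((s / 2) • v + t • w)
    have hexp : mdot A ((s / 2) • v + t • w) ((s / 2) • v + t • w)
        = 1 / 4 * (s ^ 2 * mdot A v v) + s * t * mdot A w v + t ^ 2 * mdot A w w := by
      rw [mdot_add_left, mdot_smul_left, mdot_smul_left,
        mdot_comm_of_isSymm hAsymm v, mdot_comm_of_isSymm hAsymm w,
        mdot_add_left, mdot_add_left, mdot_smul_left, mdot_smul_left, mdot_smul_left,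
        mdot_smul_left, mdot_comm_of_isSymm hAsymm v w]
      ring
    linarith
  have hAw : mdot A w w ≤ (d : ℝ) ^ 4 * matSup A * ‖w‖ ^ 2 := by
    have h1 := (le_abs_self _).trans (abs_mdot_le A w w)
    have h2 : (d : ℝ) ^ 2 ≤ (d : ℝ) ^ 4 := pow_le_pow_right₀ hd1 (by norm_num)
    have h3 : 0 ≤ matSup A * ‖w‖ * ‖w‖ :=
      mul_nonneg (mul_nonneg (matSup_nonneg A) (norm_nonneg _)) (norm_nonneg _)
    nlinarith [mul_le_mul_of_nonneg_right h2 h3]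
  have hC : -(s * t * mdot C w v) ≤ 1 / 4 * (s ^ 2 * mdot A v v)
      + t ^ 2 * ((d : ℝ) ^ 4 * (matSup C ^ 2 * (PhiA A)⁻¹) * ‖w‖ ^ 2) := by
    have h1 : -(s * t * mdot C w v) ≤ |s| * |t| * ((d : ℝ) ^ 2 * (matSup C * ‖w‖ * ‖v‖)) := by
      refine (neg_le_abs _).trans ?_
      rw [abs_mul, abs_mul]
      gcongr
      exact abs_mdot_le C w v
    have h2 : s ^ 2 * (PhiA A * ‖v‖ ^ 2) ≤ s ^ 2 * mdot A v v :=
      mul_le_mul_of_nonneg_left (PhiA_mul_norm_sq_le hApos v) (sq_nonneg s)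
    have h3 : |s| * |t| * ((d : ℝ) ^ 2 * (matSup C * ‖w‖ * ‖v‖)) ≤
        1 / 4 * (s ^ 2 * (PhiA A * ‖v‖ ^ 2))
        + t ^ 2 * ((d : ℝ) ^ 4 * (matSup C ^ 2 * (PhiA A)⁻¹) * ‖w‖ ^ 2) := by
      have h4 : 0 ≤ (PhiA A)⁻¹ *
          (|s| * PhiA A * ‖v‖ / 2 - |t| * (d : ℝ) ^ 2 * matSup C * ‖w‖) ^ 2 := by positivity
      have h5 : (PhiA A)⁻¹ * (|s| * PhiA A * ‖v‖ / 2 - |t| * (d : ℝ) ^ 2 * matSup C * ‖w‖) ^ 2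
          = 1 / 4 * (|s| ^ 2 * (PhiA A * ‖v‖ ^ 2))
            + |t| ^ 2 * ((d : ℝ) ^ 4 * (matSup C ^ 2 * (PhiA A)⁻¹) * ‖w‖ ^ 2)
            - |s| * |t| * ((d : ℝ) ^ 2 * (matSup C * ‖w‖ * ‖v‖)) := by
        field_simp
        ring
      rw [sq_abs, sq_abs] at h5
      linarith
    linarith
  nlinarith [mul_le_mul_of_nonneg_left hAw (sq_nonneg t)]

/-- The energy (Caccioppoli) estimate for the weak resolvent identity, tested against
`u = h * χ ^ 2`. -/
theorem WeakResolvent.integral_sq_mul_sq_le {d : ℕ} (hd : 0 < d)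
    {μ : Measure (EuclideanSpace ℝ (Fin d))} [IsFiniteMeasureOnCompacts μ]
    {A C : EuclideanSpace ℝ (Fin d) → Matrix (Fin d) (Fin d) ℝ}
    (hAc : ∀ i j, Continuous fun x => A x i j)
    (hAsymm : ∀ x, (A x).IsSymm) (hApos : ∀ x, (A x).PosDef)
    (hCc : ∀ i j, Continuous fun x => C x i j)
    (hCanti : ∀ x, (C x).transpose = -(C x))
    {Bb : EuclideanSpace ℝ (Fin d) → EuclideanSpace ℝ (Fin d)}
    (hBmeas : Measurable Bb) (hBloc : LocallyIntegrable (fun x => ‖Bb x‖) μ)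
    (hBdiv : ∀ f : EuclideanSpace ℝ (Fin d) → ℝ, (∃ K, LipschitzWith K f) →
      HasCompactSupport f → ∫ x, ⟪Bb x, gradient f x⟫ ∂μ = 0)
    {h : EuclideanSpace ℝ (Fin d) → ℝ} (hh1 : ContDiff ℝ 1 h) (hres : WeakResolvent μ A C Bb h)
    {χ : EuclideanSpace ℝ (Fin d) → ℝ} (hχ1 : ContDiff ℝ 1 χ) (hχs : HasCompactSupport χ)
    {F : EuclideanSpace ℝ (Fin d) → ℝ} (hF : Integrable F μ)
    (hFle : ∀ x, h x ^ 2 * ((d : ℝ) ^ 4 * (matSup (A x) + matSup (C x) ^ 2 * (PhiA (A x))⁻¹)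
      * ‖gradient χ x‖ ^ 2 + |χ x| * (‖Bb x‖ * ‖gradient χ x‖)) ≤ F x) :
    ∫ x, χ x ^ 2 * h x ^ 2 ∂μ ≤ ∫ x, F x ∂μ := by
  set p : EuclideanSpace ℝ (Fin d) → ℝ := fun x => h x * χ x with hp
  set u : EuclideanSpace ℝ (Fin d) → ℝ := fun x => p x * χ x with hu
  let f : EuclideanSpace ℝ (Fin d) → ℝ := fun x => p x * p x
  have hp1 : ContDiff ℝ 1 p := hh1.mul hχ1
  have hu1 : ContDiff ℝ 1 u := hp1.mul hχ1
  have hf1 : ContDiff ℝ 1 f := hp1.mul hp1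
  have hps : HasCompactSupport p := hχs.mul_left
  have hus : HasCompactSupport u := hχs.mul_left
  have hfs : HasCompactSupport f := hps.mul_left
  have hgp : ∀ x, gradient p x = h x • gradient χ x + χ x • gradient h x := fun x =>
    gradient_fun_mul (hh1.differentiable one_ne_zero x) (hχ1.differentiable one_ne_zero x)
  have hgu : ∀ x, gradient u x = p x • gradient χ x + χ x • gradient p x := fun x =>
    gradient_fun_mul (hp1.differentiable one_ne_zero x) (hχ1.differentiable one_ne_zero x)
  have hgf : ∀ x, gradient f x = p x • gradient p x + p x • gradient p x := fun x =>
    gradient_fun_mul (hp1.differentiable one_ne_zero x) (hp1.differentiable one_ne_zero x)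
  have I1 : Integrable (fun x => mdot (A x + C x) (gradient u x) (gradient h x)) μ := by
    refine (continuous_mdot (fun i j => (hAc i j).add (hCc i j)) hu1.continuous_gradient
      hh1.continuous_gradient).integrable_of_hasCompactSupport (hus.gradient.mono ?_)
    intro x hx h0
    exact hx (by simp [mdot, h0])
  have I2 : Integrable (fun x => ⟪Bb x, gradient u x⟫ * h x) μ := by
    have := hBloc.integrable_inner_of_hasCompactSupport hBmeas
      (hh1.continuous.smul hu1.continuous_gradient) hus.gradient.smul_left
    refine this.congr (.of_forall fun x => ?_)
    simp [real_inner_smul_right, mul_comm]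
  have I3 : Integrable (fun x => u x * h x) μ :=
    (hu1.continuous.mul hh1.continuous).integrable_of_hasCompactSupport hus.mul_right
  have I4 : Integrable (fun x => ⟪Bb x, gradient f x⟫) μ :=
    hBloc.integrable_inner_of_hasCompactSupport hBmeas hf1.continuous_gradient hfs.gradient
  have I5 : Integrable (fun x => χ x ^ 2 * h x ^ 2) μ :=
    I3.congr (.of_forall fun x => by simp only [hu, hp]; ring)
  have hzero : ∫ x, (1 / 2 * mdot (A x + C x) (gradient u x) (gradient h x)
      + ⟪Bb x, gradient u x⟫ * h x + u x * h x - 1 / 2 * ⟪Bb x, gradient f x⟫) ∂μ = 0 := by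
    rw [integral_sub (by exact ((I1.const_mul _).add I2).add I3) (I4.const_mul _),
      integral_add (by exact (I1.const_mul _).add I2) I3, integral_add (I1.const_mul _) I2,
      integral_const_mul, integral_const_mul,
      hBdiv f (hf1.lipschitzWith_of_hasCompactSupport hfs one_ne_zero) hfs,
      hres u (hu1.lipschitzWith_of_hasCompactSupport hus one_ne_zero) hus]
    ring
  have IG := (((I1.const_mul (1 / 2)).add I2).add I3).sub (I4.const_mul (1 / 2))
  have hmono := integral_mono I5 (IG.add hF) fun x => by
    have hest := mdot_cutoff_estimate (C := C x) hd (hAsymm x) (hApos x) (χ x) (h x)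
      (gradient h x) (gradient χ x)
    have hB : -(h x ^ 2 * (χ x * ⟪Bb x, gradient χ x⟫)) ≤
        h x ^ 2 * (|χ x| * (‖Bb x‖ * ‖gradient χ x‖)) := by
      rw [← mul_neg]
      refine mul_le_mul_of_nonneg_left ((neg_le_abs _).trans ?_) (sq_nonneg _)
      rw [abs_mul]
      exact mul_le_mul_of_nonneg_left (abs_real_inner_le_norm _ _) (abs_nonneg _)
    have hG : 1 / 2 * mdot (A x + C x) (gradient u x) (gradient h x)
        + ⟪Bb x, gradient u x⟫ * h x + u x * h x - 1 / 2 * ⟪Bb x, gradient f x⟫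
        = χ x ^ 2 * h x ^ 2 + (1 / 2 * (χ x ^ 2 * mdot (A x) (gradient h x) (gradient h x))
          + χ x * h x * mdot (A x) (gradient χ x) (gradient h x)
          + χ x * h x * mdot (C x) (gradient χ x) (gradient h x))
          + h x ^ 2 * (χ x * ⟪Bb x, gradient χ x⟫) := by
      simp only [hgu, hgf, hgp, mdot_add_matrix, mdot_add_left, mdot_smul_left, inner_add_right,
        real_inner_smul_right, mdot_self_eq_zero_of_antisymm (hCanti x)]
      simp only [hu, hp]
      ring
    have := hFle x
    simp only [Pi.add_apply, Pi.sub_apply]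
    rw [hG]
    linarith
  rw [integral_add' IG hF] at hmono
  simp only [Pi.add_apply, Pi.sub_apply] at hmono
  rwa [hzero, zero_add] at hmono

/-- Theorem 3.1(ii): if `(|A|_∞ + |C|_∞² Φ_A⁻¹)/(1+‖x‖²) + ‖B̄‖/(1+‖x‖)` is `μ`-integrable,
then every bounded `C¹` function satisfying the weak resolvent identity vanishes identically. -/
theorem stmt1 {d : ℕ} (hd : 2 ≤ d)
    (ρ : EuclideanSpace ℝ (Fin d) → ℝ) (hρc : Continuous ρ) (hρ : ∀ x, 0 < ρ x)
    (μ : Measure (EuclideanSpace ℝ (Fin d)))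
    (hμ : μ = volume.withDensity fun x => ENNReal.ofReal (ρ x))
    (A C : EuclideanSpace ℝ (Fin d) → Matrix (Fin d) (Fin d) ℝ)
    (hAc : ∀ i j, Continuous fun x => A x i j)
    (hAsymm : ∀ x, (A x).IsSymm) (hApos : ∀ x, (A x).PosDef)
    (hCc : ∀ i j, Continuous fun x => C x i j)
    (hCanti : ∀ x, (C x).transpose = -(C x))
    (Bb : EuclideanSpace ℝ (Fin d) → EuclideanSpace ℝ (Fin d))
    (hBmeas : Measurable Bb)
    (hBloc : LocallyIntegrable (fun x => ‖Bb x‖) μ)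
    (hBdiv : ∀ f : EuclideanSpace ℝ (Fin d) → ℝ, (∃ K, LipschitzWith K f) →
      HasCompactSupport f → ∫ x, ⟪Bb x, gradient f x⟫ ∂μ = 0)
    (hint : Integrable (fun x =>
      (matSup (A x) + matSup (C x) ^ 2 * (PhiA (A x))⁻¹) / (1 + ‖x‖ ^ 2)
        + ‖Bb x‖ / (1 + ‖x‖)) μ)
    (h : EuclideanSpace ℝ (Fin d) → ℝ) (hh1 : ContDiff ℝ 1 h)
    (hhb : ∃ M, ∀ x, |h x| ≤ M)
    (hres : WeakResolvent μ A C Bb h) :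
    ∀ x, h x = 0 := by
  have hd0 : 0 < d := by omega
  have : IsLocallyFiniteMeasure μ := hμ ▸ IsLocallyFiniteMeasure.withDensity_ofReal hρc
  have : μ.IsOpenPosMeasure := by
    have hac : (volume : Measure (EuclideanSpace ℝ (Fin d))) ≪ μ := by
      rw [hμ]
      exact withDensity_absolutelyContinuous' hρc.measurable.ennreal_ofReal.aemeasurable
        (.of_forall fun x => by simpa using hρ x)
    exact hac.isOpenPosMeasure
  obtain ⟨M, hM⟩ := hhb
  set F : EuclideanSpace ℝ (Fin d) → ℝ := fun x =>
    (matSup (A x) + matSup (C x) ^ 2 * (PhiA (A x))⁻¹) / (1 + ‖x‖ ^ 2)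
      + ‖Bb x‖ / (1 + ‖x‖) with hF
  intro x₀
  by_contra hx₀
  obtain ⟨ψ, hψ1, hψs, hψ0, hψle, hψone, -, -⟩ :=
    exists_cutoff_gradient_le (E := EuclideanSpace ℝ (Fin d)) one_pos ‖x₀‖
  have hψhc : Continuous fun x => ψ x ^ 2 * h x ^ 2 :=
    (hψ1.continuous.pow 2).mul (hh1.continuous.pow 2)
  have hsq : ∀ {χ : EuclideanSpace ℝ (Fin d) → ℝ}, HasCompactSupport χ →
      HasCompactSupport fun x => χ x ^ 2 * h x ^ 2 := fun {χ} hχ =>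
    (hχ.comp_left (g := fun t : ℝ => t ^ 2) (by simp)).mul_right
  have hpos : 0 < ∫ x, ψ x ^ 2 * h x ^ 2 ∂μ :=
    hψhc.integral_pos_of_hasCompactSupport_nonneg_nonzero (hsq hψs)
      (fun x => by positivity) (x := x₀) (by simp [hψone x₀ le_rfl, hx₀])
  obtain ⟨R, hR⟩ := hψs.isCompact.isBounded.exists_norm_le
  have hle : ∀ ε > 0, ∫ x, ψ x ^ 2 * h x ^ 2 ∂μ ≤ ε * (M ^ 2 * (d : ℝ) ^ 4 * ∫ x, F x ∂μ) := by
    intro ε hε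
    obtain ⟨χ, hχ1, hχs, hχ0, hχle, hχone, hχsq, hχgrad⟩ :=
      exists_cutoff_gradient_le (E := EuclideanSpace ℝ (Fin d)) hε R
    have hψχ : ∀ x, ψ x ≤ χ x := fun x => by
      by_cases hx : ψ x = 0
      · rw [hx]
        exact hχ0 x
      · rw [hχone x (hR x (subset_tsupport ψ hx))]
        exact hψle x
    calc ∫ x, ψ x ^ 2 * h x ^ 2 ∂μ ≤ ∫ x, χ x ^ 2 * h x ^ 2 ∂μ := by
          refine integral_mono (hψhc.integrable_of_hasCompactSupport (hsq hψs))
            (((hχ1.continuous.pow 2).mul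
              (hh1.continuous.pow 2)).integrable_of_hasCompactSupport (hsq hχs)) fun x => ?_
          have := hψ0 x
          have := hψχ x
          dsimp only
          gcongr
      _ ≤ ∫ x, ε * (M ^ 2 * (d : ℝ) ^ 4) * F x ∂μ := by
          refine hres.integral_sq_mul_sq_le hd0 hAc hAsymm hApos hCc hCanti hBmeas hBloc hBdiv
            hh1 hχ1 hχs (hint.const_mul _) fun x => ?_
          have hP : 0 ≤ matSup (A x) + matSup (C x) ^ 2 * (PhiA (A x))⁻¹ := by
            have := matSup_nonneg (A x)
            have := PhiA_pos hd0 (hApos x)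
            positivity
          have hhM : h x ^ 2 ≤ M ^ 2 := sq_le_sq' (neg_le_of_abs_le (hM x)) (le_of_abs_le (hM x))
          have hd4 : (1 : ℝ) ≤ (d : ℝ) ^ 4 := one_le_pow₀ (by exact_mod_cast hd0)
          have hχabs : |χ x| ≤ (d : ℝ) ^ 4 := by
            rw [abs_of_nonneg (hχ0 x)]
            exact (hχle x).trans hd4
          calc _ ≤ M ^ 2 * ((d : ℝ) ^ 4 * (matSup (A x) + matSup (C x) ^ 2 * (PhiA (A x))⁻¹)
                * (ε / (1 + ‖x‖ ^ 2)) + (d : ℝ) ^ 4 * (‖Bb x‖ * (ε / (1 + ‖x‖)))) := by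
                gcongr
                · exact hχsq x
                · exact hχgrad x
            _ = ε * (M ^ 2 * (d : ℝ) ^ 4) * F x := by
                simp only [hF]
                ring
      _ = ε * (M ^ 2 * (d : ℝ) ^ 4 * ∫ x, F x ∂μ) := by
          rw [integral_const_mul]
          ring
  have hlim : Filter.Tendsto (fun ε : ℝ => ε * (M ^ 2 * (d : ℝ) ^ 4 * ∫ x, F x ∂μ))
      (nhdsWithin 0 (Set.Ioi 0)) (nhds 0) :=
    (Continuous.tendsto' (by fun_prop) 0 0 (by simp)).mono_left nhdsWithin_le_nhds
  exact hpos.not_ge (ge_of_tendsto hlim (Filter.eventually_of_mem self_mem_nhdsWithin hle))
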